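/- With the algorithm setup (n = dℓ, k = dr + c, c ∈ {−1,0,1}): if 1 ≤ i, j ≤ ℓ − r + 1 with i ≠ j, I ∈ L_i, and J ∈ L_j, then I and J are weakly separated. -/

import Mathlib

open Finset

/-- `x +_n t`: add `t` to `x ∈ [n] = {1,…,n}` modulo `n`, with representative in `[n]`. -/
def shiftMod (n t x : ℕ) : ℕ := (x + t - 1) % n + 1

/-- `S +_n t`: add `t` to every element of `S ⊆ [n]` modulo `n`. -/
def shiftSet (n t : ℕ) (S : Finset ℕ) : Finset ℕ := S.image (shiftMod n t)

/-- `x +_n t` for an integer shift `t`. -/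
def shiftModZ (n : ℕ) (t : ℤ) (x : ℕ) : ℕ := ((((x : ℤ) + t - 1) % (n : ℤ)) + 1).toNat

/-- `S +_n t` for an integer shift `t`. -/
def shiftSetZ (n : ℕ) (t : ℤ) (S : Finset ℕ) : Finset ℕ := S.image (shiftModZ n t)

/-- Two sets `S`, `T` are weakly separated if there are no `a < b < c < d` with
`a, c ∈ S \ T` and `b, d ∈ T \ S`, nor with the roles of `S` and `T` exchanged. -/
def WeaklySeparated (S T : Finset ℕ) : Prop :=
  ¬ ∃ a b c d : ℕ, a < b ∧ b < c ∧ c < d ∧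
    ((a ∈ S \ T ∧ c ∈ S \ T ∧ b ∈ T \ S ∧ d ∈ T \ S) ∨
     (a ∈ T \ S ∧ c ∈ T \ S ∧ b ∈ S \ T ∧ d ∈ S \ T))

/-- The cyclic successor of `x` in a finite set `P ⊆ ℕ`: the least element of `P`
greater than `x` if one exists, and otherwise the least element of `P`. -/
def cyclicSucc (P : Finset ℕ) (x : ℕ) : ℕ :=
  if h : (P.filter (fun y => x < y)).Nonempty then (P.filter (fun y => x < y)).min' h
  else if h2 : P.Nonempty then P.min' h2 else 0

open scoped Classical in
/-- The cyclic interval of `P` from `u` to `v`: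
`{u, S_P(u), …, S_P^m(u)}` where `m ≥ 0` is minimal with `S_P^m(u) = v`. -/
noncomputable def cyclicIntervalTo (P : Finset ℕ) (u v : ℕ) : Finset ℕ :=
  if h : ∃ m : ℕ, (cyclicSucc P)^[m] u = v then
    (Finset.range (Nat.find h + 1)).image (fun j => (cyclicSucc P)^[j] u)
  else ∅

/-- The orbit `ā = {a + iℓ : 0 ≤ i ≤ d−1} ⊆ [dℓ]` of `a ∈ [ℓ]`. -/
def orbit (d ℓ a : ℕ) : Finset ℕ := (Finset.range d).image (fun i => a + i * ℓ)

/-- `P_s = [n] \ (ā_{a_1} ∪ … ∪ ā_{a_{s−1}})`, where `n = dℓ`. -/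
def Pset (d ℓ : ℕ) (a : ℕ → ℕ) (s : ℕ) : Finset ℕ :=
  Finset.Icc 1 (d * ℓ) \ (Finset.Icc 1 (s - 1)).biUnion (fun i => orbit d ℓ (a i))

/-- `P_{s,h} = P_s \ {a_s +_n hℓ, …, a_s +_n (d−1)ℓ}` for `1 ≤ h ≤ d−1`; `P_{s,d} = P_s`. -/
def Psh (d ℓ : ℕ) (a : ℕ → ℕ) (s h : ℕ) : Finset ℕ :=
  Pset d ℓ a s \ (Finset.Ico h d).image (fun j => shiftMod (d * ℓ) (j * ℓ) (a s))

/-- `I(i,h) = {i, S_{P_{s,h}}(i), S_{P_{s,h}}²(i), …, S_{P_{s,h}}^{k−1}(i)}`. -/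
def Iih (d ℓ k : ℕ) (a : ℕ → ℕ) (s h i : ℕ) : Finset ℕ :=
  (Finset.range k).image (fun j => (cyclicSucc (Psh d ℓ a s h))^[j] i)

/-- `B_s = {I(i,h) : i` in the cyclic interval of `P_s` from `S_{P_s}(a_s +_n (n−ℓ))` to
`a_s`, `1 ≤ h ≤ d`, `|I(i,h)| = k}`. -/
noncomputable def Bset (d ℓ k : ℕ) (a : ℕ → ℕ) (s : ℕ) : Finset (Finset ℕ) :=
  (((cyclicIntervalTo (Pset d ℓ a s)
        (cyclicSucc (Pset d ℓ a s) (shiftMod (d * ℓ) (d * ℓ - ℓ) (a s)))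
        (a s)) ×ˢ (Finset.Icc 1 d)).image
      (fun p => Iih d ℓ k a s p.2 p.1)).filter (fun I => I.card = k)

/-- `L_s = {I +_n xℓ : I ∈ B_s, 1 ≤ x ≤ d}`. -/
noncomputable def Lset (d ℓ k : ℕ) (a : ℕ → ℕ) (s : ℕ) : Finset (Finset ℕ) :=
  ((Bset d ℓ k a s) ×ˢ (Finset.Icc 1 d)).image (fun p => shiftSet (d * ℓ) (p.2 * ℓ) p.1)

/-- The output collection `D = L_1 ∪ … ∪ L_{ℓ−r+1}`. -/
noncomputable def Dcol (d ℓ k r : ℕ) (a : ℕ → ℕ) : Finset (Finset ℕ) :=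
  (Finset.Icc 1 (ℓ - r + 1)).biUnion (fun s => Lset d ℓ k a s)

/-- The map `F : [n] → [dℓ]`, `F(a + gx) = a + ℓx` for `1 ≤ a ≤ g`, `0 ≤ x ≤ d−1`. -/
def Fmap (g ℓ y : ℕ) : ℕ := (y - 1) % g + 1 + ℓ * ((y - 1) / g)

/-- `a, c` separate `b, d` in the cyclic order on the natural numbers. -/
def CyclicCross (a b c d : ℕ) : Prop :=
  (a < b ∧ b < c ∧ c < d) ∨ (b < c ∧ c < d ∧ d < a) ∨
    (c < d ∧ d < a ∧ a < b) ∨ (d < a ∧ a < b ∧ b < c)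

/-- No two elements of `K` separate two elements of `Q \ K` cyclically. -/
def NonCrossing (Q K : Finset ℕ) : Prop :=
  ∀ a ∈ K, ∀ c ∈ K, ∀ b ∈ Q \ K, ∀ d ∈ Q \ K, ¬ CyclicCross a b c d

theorem NonCrossing.weaklySeparated {Q K J : Finset ℕ} (h : NonCrossing Q K) (hJ : J ⊆ Q) :
    WeaklySeparated K J := by
  rintro ⟨a, b, c, d, hab, hbc, hcd, H⟩
  simp only [mem_sdiff] at H
  rcases H with ⟨⟨ha, -⟩, ⟨hc, -⟩, ⟨hb, hb'⟩, ⟨hd, hd'⟩⟩ | ⟨⟨ha, ha'⟩, ⟨hc, hc'⟩, ⟨hb, -⟩, ⟨hd, -⟩⟩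
  · exact h a ha c hc b (mem_sdiff.2 ⟨hJ hb, hb'⟩) d (mem_sdiff.2 ⟨hJ hd, hd'⟩)
      (Or.inl ⟨hab, hbc, hcd⟩)
  · exact h b hb d hd c (mem_sdiff.2 ⟨hJ hc, hc'⟩) a (mem_sdiff.2 ⟨hJ ha, ha'⟩)
      (Or.inr (Or.inr (Or.inr ⟨hab, hbc, hcd⟩)))

theorem WeaklySeparated.symm {S T : Finset ℕ} (h : WeaklySeparated S T) :
    WeaklySeparated T S := by
  rintro ⟨a, b, c, d, hab, hbc, hcd, H⟩
  exact h ⟨a, b, c, d, hab, hbc, hcd, H.symm⟩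

theorem weaklySeparated_of_card_le_one {S T : Finset ℕ} (hS : S.card ≤ 1) :
    WeaklySeparated S T := by
  rw [card_le_one] at hS
  rintro ⟨a, b, c, d, hab, hbc, hcd, H⟩
  simp only [mem_sdiff] at H
  rcases H with ⟨⟨ha, -⟩, ⟨hc, -⟩, -⟩ | ⟨-, -, ⟨hb, -⟩, ⟨hd, -⟩⟩
  · have := hS a ha c hc
    omega
  · have := hS b hb d hd
    omega

theorem cyclicSucc_mem {P : Finset ℕ} (hP : P.Nonempty) (x : ℕ) : cyclicSucc P x ∈ P := by
  unfold cyclicSucc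
  split_ifs with h
  · exact (mem_filter.1 (min'_mem _ h)).1
  · exact min'_mem _ hP

/-- The successor is either the next larger element or, past the maximum, the least element. -/
theorem cyclicSucc_spec {P : Finset ℕ} (hP : P.Nonempty) (x : ℕ) :
    (x < cyclicSucc P x ∧ ∀ y ∈ P, x < y → cyclicSucc P x ≤ y) ∨
      ((∀ y ∈ P, y ≤ x) ∧ ∀ y ∈ P, cyclicSucc P x ≤ y) := by
  unfold cyclicSucc
  split_ifs with h
  · exact Or.inl ⟨(mem_filter.1 (min'_mem _ h)).2,
      fun y hy hxy => min'_le _ _ (mem_filter.2 ⟨hy, hxy⟩)⟩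
  · refine Or.inr ⟨fun y hy => ?_, fun y hy => min'_le _ _ hy⟩
    by_contra hxy
    exact h ⟨y, mem_filter.2 ⟨hy, by omega⟩⟩

theorem iterate_cyclicSucc_mem {P Q : Finset ℕ} (hP : P.Nonempty) (hPQ : P ⊆ Q) {x : ℕ}
    (hx : x ∈ Q) (m : ℕ) : (cyclicSucc P)^[m] x ∈ Q := by
  cases m with
  | zero => exact hx
  | succ m =>
    rw [Function.iterate_succ_apply']
    exact hPQ (cyclicSucc_mem hP _)

/-- The first `k + 1` iterates of the successor cut out a cyclic arc of `Q`, or all of `Q`. -/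
theorem iterate_cyclicSucc_arc {Q : Finset ℕ} (hQ : Q.Nonempty) (y k : ℕ) :
    let K := (range (k + 1)).image fun j => (cyclicSucc Q)^[j] y
    let z := (cyclicSucc Q)^[k] y
    (y ≤ z ∧ (∀ x ∈ K, y ≤ x ∧ x ≤ z) ∧ ∀ x ∈ Q, y ≤ x → x ≤ z → x ∈ K) ∨
      (z < y ∧ (∀ x ∈ K, y ≤ x ∨ x ≤ z) ∧ ∀ x ∈ Q, y ≤ x ∨ x ≤ z → x ∈ K) ∨ Q ⊆ K := by
  induction k with
  | zero =>
    refine Or.inl ⟨le_rfl, ?_, ?_⟩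
    · simp
    · intro x _ h1 h2
      have : x = y := le_antisymm h2 h1
      simp [this]
  | succ k ih =>
    simp only at ih ⊢
    rw [range_add_one (n := k + 1), image_insert, Function.iterate_succ_apply']
    set K := (range (k + 1)).image fun j => (cyclicSucc Q)^[j] y
    set z := (cyclicSucc Q)^[k] y
    have hspec := cyclicSucc_spec hQ z
    set w := cyclicSucc Q z
    simp only [mem_insert, forall_eq_or_imp]
    rcases ih with ⟨hyz, hK, hQK⟩ | ⟨hzy, hK, hQK⟩ | hQK
    · rcases hspec with ⟨hzw, hw⟩ | ⟨hz, hw⟩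
      · refine Or.inl ⟨by omega, ⟨by omega, fun x hx => ?_⟩, fun x hx h1 h2 => ?_⟩
        · have := hK x hx
          omega
        · by_cases hxz : x ≤ z
          · exact Or.inr (hQK x hx h1 hxz)
          · have := hw x hx (by omega)
            omega
      · by_cases hwy : w < y
        · refine Or.inr (Or.inl ⟨hwy, ⟨by omega, fun x hx => Or.inl (hK x hx).1⟩,
            fun x hx h => ?_⟩)
          rcases h with h | h
          · exact Or.inr (hQK x hx h (hz x hx))
          · have := hw x hx
            omega
        · refine Or.inr (Or.inr fun x hx => mem_insert_of_mem (hQK x hx ?_ (hz x hx)))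
          have := hw x hx
          omega
    · by_cases hwy : z < w ∧ w < y
      · refine Or.inr (Or.inl ⟨hwy.2, ⟨by omega, fun x hx => ?_⟩, fun x hx h => ?_⟩)
        · have := hK x hx
          omega
        · by_cases hxz : y ≤ x ∨ x ≤ z
          · exact Or.inr (hQK x hx hxz)
          · rcases hspec with ⟨-, hw⟩ | ⟨hz, -⟩
            · have := hw x hx (by omega)
              omega
            · have := hz x hx
              omega
      · refine Or.inr (Or.inr fun x hx => mem_insert_of_mem (hQK x hx ?_))
        rcases hspec with ⟨hzw, hw⟩ | ⟨hz, -⟩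
        · have := hw x hx
          omega
        · exact Or.inr (hz x hx)
    · exact Or.inr (Or.inr (hQK.trans (subset_insert _ _)))

theorem nonCrossing_iterate_cyclicSucc {Q : Finset ℕ} (hQ : Q.Nonempty) (y k : ℕ) :
    NonCrossing Q ((range k).image fun j => (cyclicSucc Q)^[j] y) := by
  intro a ha c hc b hb d hd hx
  cases k with
  | zero => simp at ha
  | succ k =>
    obtain ⟨hbQ, hb⟩ := mem_sdiff.1 hb
    obtain ⟨hdQ, hd⟩ := mem_sdiff.1 hd
    unfold CyclicCross at hx
    rcases iterate_cyclicSucc_arc hQ y k with ⟨-, hK, hQK⟩ | ⟨-, hK, hQK⟩ | hQK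
    · have := hK a ha
      have := hK c hc
      have hb' : ¬ (y ≤ b ∧ b ≤ _) := fun h => hb (hQK b hbQ h.1 h.2)
      have hd' : ¬ (y ≤ d ∧ d ≤ _) := fun h => hd (hQK d hdQ h.1 h.2)
      omega
    · have := hK a ha
      have := hK c hc
      have hb' : ¬ (y ≤ b ∨ b ≤ _) := fun h => hb (hQK b hbQ h)
      have hd' : ¬ (y ≤ d ∨ d ≤ _) := fun h => hd (hQK d hdQ h)
      omega
    · exact hb (hQK hbQ)

theorem shiftMod_cases {n x : ℕ} (t : ℕ) (hx : x ∈ Icc 1 n) :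
    (x + t % n ≤ n ∧ shiftMod n t x = x + t % n) ∨
      (n < x + t % n ∧ shiftMod n t x + n = x + t % n) := by
  obtain ⟨h1, h2⟩ := mem_Icc.1 hx
  have ht := Nat.mod_lt t (show 0 < n by omega)
  have hmod : (x + t - 1) % n = (x - 1 + t % n) % n := by
    rw [Nat.add_mod_mod]
    congr 1
    omega
  unfold shiftMod
  rw [hmod]
  generalize t % n = u at ht ⊢
  by_cases h : x + u ≤ n
  · rw [Nat.mod_eq_of_lt (by omega)]
    omega
  · rw [Nat.mod_eq_sub_mod (by omega), Nat.mod_eq_of_lt (by omega)]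
    omega

theorem NonCrossing.shiftSet {n t : ℕ} {Q K : Finset ℕ} (h : NonCrossing Q K)
    (hQ : Q ⊆ Icc 1 n) (hK : K ⊆ Icc 1 n) :
    NonCrossing (shiftSet n t Q) (shiftSet n t K) := by
  intro a ha c hc b hb d hd hx
  simp only [_root_.shiftSet, mem_sdiff, mem_image] at ha hc hb hd
  obtain ⟨a, ha, rfl⟩ := ha
  obtain ⟨c, hc, rfl⟩ := hc
  obtain ⟨⟨b, hb, rfl⟩, hb'⟩ := hb
  obtain ⟨⟨d, hd, rfl⟩, hd'⟩ := hd
  refine h a ha c hc b (mem_sdiff.2 ⟨hb, fun hbK => hb' ⟨b, hbK, rfl⟩⟩)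
    d (mem_sdiff.2 ⟨hd, fun hdK => hd' ⟨d, hdK, rfl⟩⟩) ?_
  have := mem_Icc.1 (hK ha)
  have := mem_Icc.1 (hK hc)
  have := mem_Icc.1 (hQ hb)
  have := mem_Icc.1 (hQ hd)
  unfold CyclicCross at hx ⊢
  rcases shiftMod_cases t (hK ha) with ha | ha <;>
  rcases shiftMod_cases t (hK hc) with hc | hc <;>
  rcases shiftMod_cases t (hQ hb) with hb | hb <;>
  rcases shiftMod_cases t (hQ hd) with hd | hd <;>
  omega

theorem shiftMod_mem_Icc {n : ℕ} (hn : 0 < n) (t x : ℕ) : shiftMod n t x ∈ Icc 1 n := by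
  have := Nat.mod_lt (x + t - 1) hn
  rw [mem_Icc, shiftMod]
  omega

theorem shiftMod_modEq (d ℓ t : ℕ) {x : ℕ} (hx : 1 ≤ x) :
    shiftMod (d * ℓ) (t * ℓ) x ≡ x [MOD ℓ] := by
  have h1 : (x + t * ℓ - 1) % (d * ℓ) ≡ x + t * ℓ - 1 [MOD ℓ] :=
    (Nat.mod_modEq _ _).of_mul_left d
  have h2 : shiftMod (d * ℓ) (t * ℓ) x ≡ x + t * ℓ - 1 + 1 [MOD ℓ] := h1.add_right 1
  rw [Nat.sub_add_cancel (by omega)] at h2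
  exact h2.trans (by simp [Nat.ModEq])

/-- Shifting by `(d - t) * ℓ` is undone by shifting by `t * ℓ`. -/
theorem shiftMod_shiftMod_cancel {d ℓ t x : ℕ} (hx : x ∈ Icc 1 (d * ℓ)) (ht : t ≤ d) :
    shiftMod (d * ℓ) (t * ℓ) (shiftMod (d * ℓ) ((d - t) * ℓ) x) = x := by
  obtain ⟨h1, h2⟩ := mem_Icc.1 hx
  have hsum : (d - t) * ℓ + t * ℓ = d * ℓ := by rw [← Nat.add_mul, Nat.sub_add_cancel ht]
  unfold shiftMod
  have : (x + (d - t) * ℓ - 1) % (d * ℓ) + 1 + t * ℓ - 1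
      = (x + (d - t) * ℓ - 1) % (d * ℓ) + t * ℓ := by omega
  rw [this, Nat.mod_add_mod]
  have : x + (d - t) * ℓ - 1 + t * ℓ = x - 1 + d * ℓ := by omega
  rw [this, Nat.add_mod_right, Nat.mod_eq_of_lt (by omega)]
  omega

theorem mem_orbit_iff {d ℓ a x : ℕ} (ha : a ∈ Set.Icc 1 ℓ) (hx : x ∈ Icc 1 (d * ℓ)) :
    x ∈ orbit d ℓ a ↔ x ≡ a [MOD ℓ] := by
  obtain ⟨h1, h2⟩ := mem_Icc.1 hx
  obtain ⟨ha1, ha2⟩ := ha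
  simp only [orbit, mem_image, mem_range]
  constructor
  · rintro ⟨i, -, rfl⟩
    simp [Nat.ModEq]
  · intro h
    have hax : a ≤ x := by
      by_contra hlt
      have hdvd := (Nat.modEq_iff_dvd' (by omega : x ≤ a)).1 h
      have := Nat.le_of_dvd (by omega) hdvd
      omega
    obtain ⟨i, hi⟩ := (Nat.modEq_iff_dvd' hax).1 h.symm
    refine ⟨i, ?_, by rw [mul_comm]; omega⟩
    refine Nat.lt_of_mul_lt_mul_left (a := ℓ) ?_
    rw [mul_comm ℓ d]
    omega

theorem mem_Pset_iff {d ℓ s x : ℕ} {a : ℕ → ℕ} (ha : Set.BijOn a (Set.Icc 1 ℓ) (Set.Icc 1 ℓ))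
    (hs : s ≤ ℓ) :
    x ∈ Pset d ℓ a s ↔ x ∈ Icc 1 (d * ℓ) ∧ ∀ m, 1 ≤ m → m < s → ¬ x ≡ a m [MOD ℓ] := by
  rw [Pset, mem_sdiff]
  refine and_congr_right fun hx => ?_
  simp only [mem_biUnion, not_exists, not_and]
  refine forall_congr' fun m => ?_
  rw [mem_Icc]
  constructor
  · intro h h1 h2
    rw [← mem_orbit_iff (d := d) (ha.mapsTo ⟨h1, by omega⟩) hx]
    exact h ⟨h1, by omega⟩
  · rintro h ⟨h1, h2⟩
    rw [mem_orbit_iff (ha.mapsTo ⟨h1, by omega⟩) hx]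
    exact h h1 (by omega)

section

variable {d ℓ s : ℕ} {a : ℕ → ℕ}

theorem self_mem_Pset (hd : 1 ≤ d) (ha : Set.BijOn a (Set.Icc 1 ℓ) (Set.Icc 1 ℓ))
    (hs1 : 1 ≤ s) (hs : s ≤ ℓ) : a s ∈ Pset d ℓ a s := by
  obtain ⟨h1, h2⟩ := ha.mapsTo ⟨hs1, hs⟩
  have hle : ℓ ≤ d * ℓ := Nat.le_mul_of_pos_left ℓ hd
  refine (mem_Pset_iff ha hs).2 ⟨mem_Icc.2 ⟨h1, h2.trans hle⟩, fun m hm1 hm2 h => ?_⟩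
  obtain ⟨h3, h4⟩ := ha.mapsTo (⟨hm1, by omega⟩ : m ∈ Set.Icc 1 ℓ)
  have hsm : a s = a m := by
    rcases le_total (a s) (a m) with hle | hle
    · have := Nat.eq_zero_of_dvd_of_lt ((Nat.modEq_iff_dvd' hle).1 h) (by omega)
      omega
    · have := Nat.eq_zero_of_dvd_of_lt ((Nat.modEq_iff_dvd' hle).1 h.symm) (by omega)
      omega
  have := ha.injOn ⟨hs1, hs⟩ ⟨hm1, by omega⟩ hsm
  omega

theorem self_mem_Psh (hd : 1 ≤ d) (ha : Set.BijOn a (Set.Icc 1 ℓ) (Set.Icc 1 ℓ))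
    (hs1 : 1 ≤ s) (hs : s ≤ ℓ) {h : ℕ} (hh : 1 ≤ h) : a s ∈ Psh d ℓ a s h := by
  have hmem := self_mem_Pset hd ha hs1 hs
  have hIcc := ((mem_Pset_iff ha hs).1 hmem).1
  refine mem_sdiff.2 ⟨hmem, ?_⟩
  simp only [mem_image, not_exists, not_and]
  intro j hj heq
  obtain ⟨hj1, hj2⟩ := mem_Ico.1 hj
  obtain ⟨h1, h2⟩ := mem_Icc.1 hIcc
  have hlt : j * ℓ < d * ℓ := Nat.mul_lt_mul_of_pos_right hj2 (by omega)
  have hpos : 0 < j * ℓ := Nat.mul_pos (by omega) (by omega)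
  have := shiftMod_cases (j * ℓ) hIcc
  rw [Nat.mod_eq_of_lt hlt] at this
  omega

/-- Elements of `L_s` are shifts of sets of iterated successors inside `P_s`. -/
theorem exists_of_mem_Lset {k : ℕ} (hd : 1 ≤ d)
    (ha : Set.BijOn a (Set.Icc 1 ℓ) (Set.Icc 1 ℓ)) (hs1 : 1 ≤ s) (hs : s ≤ ℓ) {I : Finset ℕ}
    (hI : I ∈ Lset d ℓ k a s) :
    ∃ h i x, 1 ≤ h ∧ x ≤ d ∧ Iih d ℓ k a s h i ⊆ Pset d ℓ a s ∧
      I = shiftSet (d * ℓ) (x * ℓ) (Iih d ℓ k a s h i) := by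
  simp only [Lset, Bset, mem_image, mem_product, mem_filter, Prod.exists, mem_Icc] at hI
  obtain ⟨_, x, ⟨⟨⟨i, h, ⟨hi, hh, -⟩, rfl⟩, -⟩, -, hx⟩, rfl⟩ := hI
  have hP : (Pset d ℓ a s).Nonempty := ⟨_, self_mem_Pset hd ha hs1 hs⟩
  refine ⟨h, i, x, hh, hx, ?_, rfl⟩
  have hiP : i ∈ Pset d ℓ a s := by
    unfold cyclicIntervalTo at hi
    split_ifs at hi with hex
    · obtain ⟨m, -, rfl⟩ := mem_image.1 hi
      exact iterate_cyclicSucc_mem hP Subset.rfl (cyclicSucc_mem hP _) m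
    · simp at hi
  intro y hy
  obtain ⟨m, -, rfl⟩ := mem_image.1 hy
  exact iterate_cyclicSucc_mem ⟨_, self_mem_Psh hd ha hs1 hs hh⟩ sdiff_subset hiP m

theorem shiftMod_mem_Pset (hd : 1 ≤ d) (hl : 1 ≤ ℓ)
    (ha : Set.BijOn a (Set.Icc 1 ℓ) (Set.Icc 1 ℓ)) (hs : s ≤ ℓ) (t : ℕ) {x : ℕ}
    (hx : x ∈ Pset d ℓ a s) : shiftMod (d * ℓ) (t * ℓ) x ∈ Pset d ℓ a s := by
  rw [mem_Pset_iff ha hs] at hx ⊢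
  refine ⟨shiftMod_mem_Icc (Nat.mul_pos hd hl) _ _, fun m h1 h2 h => hx.2 m h1 h2 ?_⟩
  exact (shiftMod_modEq d ℓ t (mem_Icc.1 hx.1).1).symm.trans h

theorem Pset_subset_Psh {i j : ℕ} (ha : Set.BijOn a (Set.Icc 1 ℓ) (Set.Icc 1 ℓ)) (hi : 1 ≤ i)
    (hij : i < j) (hj : j ≤ ℓ) (h : ℕ) : Pset d ℓ a j ⊆ Psh d ℓ a i h := by
  intro x hx
  rw [mem_Pset_iff ha hj] at hx
  refine mem_sdiff.2 ⟨(mem_Pset_iff ha (by omega)).2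
    ⟨hx.1, fun m h1 h2 => hx.2 m h1 (by omega)⟩, fun hmem => ?_⟩
  obtain ⟨t, -, rfl⟩ := mem_image.1 hmem
  exact hx.2 i hi hij (shiftMod_modEq d ℓ t (ha.mapsTo ⟨hi, by omega⟩).1)

theorem weaklySeparated_of_lt {i j k : ℕ} (hd : 1 ≤ d) (hl : 1 ≤ ℓ)
    (ha : Set.BijOn a (Set.Icc 1 ℓ) (Set.Icc 1 ℓ)) (hi : 1 ≤ i) (hij : i < j) (hj : j ≤ ℓ)
    {I J : Finset ℕ} (hI : I ∈ Lset d ℓ k a i) (hJ : J ∈ Lset d ℓ k a j) :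
    WeaklySeparated I J := by
  obtain ⟨h, y, x, hh, hx, hK, rfl⟩ := exists_of_mem_Lset hd ha hi (by omega) hI
  obtain ⟨h', y', x', -, -, hK', rfl⟩ := exists_of_mem_Lset hd ha (by omega) hj hJ
  have hnc : NonCrossing (Psh d ℓ a i h) (Iih d ℓ k a i h y) :=
    nonCrossing_iterate_cyclicSucc ⟨_, self_mem_Psh hd ha hi (by omega) hh⟩ y k
  have hP : Pset d ℓ a i ⊆ Icc 1 (d * ℓ) := sdiff_subset
  refine (hnc.shiftSet (t := x * ℓ) (sdiff_subset.trans hP) (hK.trans hP)).weaklySeparated ?_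
  intro z hz
  obtain ⟨w, hw, rfl⟩ := mem_image.1 hz
  have hz' := shiftMod_mem_Pset hd hl ha hj x' (hK' hw)
  exact mem_image.2 ⟨_, Pset_subset_Psh ha hi hij hj h
    (shiftMod_mem_Pset hd hl ha hj (d - x) hz'),
    shiftMod_shiftMod_cancel ((mem_Pset_iff ha hj).1 hz').1 hx⟩

theorem card_le_of_mem_Lset {k : ℕ} {I : Finset ℕ} (hI : I ∈ Lset d ℓ k a s) : I.card ≤ k := by
  simp only [Lset, Bset, mem_image, mem_product, mem_filter, Prod.exists] at hI
  obtain ⟨_, x, ⟨⟨-, hcard⟩, -⟩, rfl⟩ := hI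
  exact card_image_le.trans hcard.le

end

/-- With the algorithm setup (`n = dℓ`, `k = dr + c`, `c ∈ {−1,0,1}`):
if `1 ≤ i, j ≤ ℓ − r + 1` with `i ≠ j`, `I ∈ L_i`, and `J ∈ L_j`, then `I` and `J` are
weakly separated. -/
theorem stmt11 (d ℓ k : ℕ) (hd : 1 ≤ d) (hl : 1 ≤ ℓ) (hk1 : 1 ≤ k) (hk2 : 2 * k ≤ d * ℓ)
    (a : ℕ → ℕ) (ha : Set.BijOn a (Set.Icc 1 ℓ) (Set.Icc 1 ℓ))
    (r : ℕ) (c : ℤ) (hc : c = -1 ∨ c = 0 ∨ c = 1) (hk : (k : ℤ) = d * r + c)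
    (i j : ℕ) (hi1 : 1 ≤ i) (hi2 : i ≤ ℓ - r + 1) (hj1 : 1 ≤ j) (hj2 : j ≤ ℓ - r + 1)
    (hij : i ≠ j)
    (I J : Finset ℕ) (hI : I ∈ Lset d ℓ k a i) (hJ : J ∈ Lset d ℓ k a j) :
    WeaklySeparated I J := by
  rcases Nat.eq_zero_or_pos r with rfl | hr
  · have hk' : k ≤ 1 := by
      push_cast at hk
      omega
    exact weaklySeparated_of_card_le_one ((card_le_of_mem_Lset hI).trans hk')
  · rcases lt_or_gt_of_ne hij with h | h
    · exact weaklySeparated_of_lt hd hl ha hi1 h (by omega) hI hJ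
    · exact (weaklySeparated_of_lt hd hl ha hj1 h (by omega) hJ hI).symm
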